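/- arXiv:2506.13418 — 3 statements merged into one kernel-verified Lean document; each statement's English description precedes it below -/
import Mathlib

section
/- Let C = Orb(S). Then ω_{2(2l+1)}(C) = (q^n − 1)/(q − 1) − (q+1) − (q+1)·q^2·((q^{4l−3} − q)(q − 1) + (q+1)(q^{4l} − 1))/(q^4 − 1); that is, the number of subspaces αS with α ∈ F^* and S ∩ αS = {0} equals this quantity. -/
open Module

section Defs

variable {F : Type*} [Field F]

/-- The subspace `α·S = {α * s : s ∈ S}` of `F`, for `S` a subspace over the subfield `Fq`. -/
noncomputable def smulSub (Fq : Subfield F) (α : F) (S : Submodule Fq F) : Submodule Fq F :=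
  S.map (LinearMap.mulLeft Fq α)

/-- The one-orbit cyclic subspace code `Orb(S) = {αS : α ∈ Fˣ}`. -/
def Orb (Fq : Subfield F) (S : Submodule Fq F) : Set (Submodule Fq F) :=
  {T | ∃ α : F, α ≠ 0 ∧ T = smulSub Fq α S}

/-- The number of subspaces `αS` (for `α ∈ Fˣ`) with `dim_{Fq}(S ∩ αS) = d`.
For `dim_{Fq} S = k` and `d = k - i` this is the weight-distribution entry `ω_{2i}(Orb S)`. -/
noncomputable def wt (Fq : Subfield F) (S : Submodule Fq F) (d : ℕ) : ℕ :=
  Set.ncard {T | T ∈ Orb Fq S ∧ finrank Fq ↥(S ⊓ T) = d}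

/-- The stabilizer `H(V) = {x ∈ Fˣ : xV = V} ∪ {0}` of a set `V ⊆ F`. -/
def HStabSet (V : Set F) : Set F :=
  {x : F | x ≠ 0 ∧ (fun y => x * y) '' V = V} ∪ {0}

/-- An `Fqt`-subspace of `F` viewed as an `Fq`-subspace, for `Fq ≤ Fqt`. -/
def toFqSub (Fq Fqt : Subfield F) (h : Fq ≤ Fqt) (W : Submodule Fqt F) : Submodule Fq F where
  carrier := W
  add_mem' := fun ha hb => W.add_mem ha hb
  zero_mem' := W.zero_mem
  smul_mem' := fun c _ hx => W.smul_mem (⟨c.1, h c.2⟩ : Fqt) hx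

/-- The subfield `Fqt` viewed as an `Fq`-subspace of `F`, for `Fq ≤ Fqt`. -/
def subfieldModule (Fq Fqt : Subfield F) (h : Fq ≤ Fqt) : Submodule Fq F where
  carrier := Fqt
  add_mem' := fun ha hb => Fqt.add_mem ha hb
  zero_mem' := Fqt.zero_mem
  smul_mem' := fun c _ hx => Fqt.mul_mem (h c.2) hx

/-- `Orb(S)` is an `r`-FWS code, where `k = dim_{Fq} S`: the weight-distribution entries
`ω_{2i}` are positive for `i ∈ {1, …, k - r}` and zero for `i ∈ {k - r + 1, …, k}`. -/
def IsRFWS (Fq : Subfield F) (S : Submodule Fq F) (k r : ℕ) : Prop :=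
  (∀ i, 1 ≤ i → i ≤ k - r → 0 < wt Fq S (k - i)) ∧
  (∀ i, k - r + 1 ≤ i → i ≤ k → wt Fq S (k - i) = 0)

end Defs

open Polynomial

section RationalFractions

variable {K : Type*} [Field K]

/-- The pairs `(A, B)` of polynomials with `B` monic of degree `m` and `deg A < m`. -/
def properPairs (K : Type*) [Field K] (m : ℕ) : Set (K[X] × K[X]) :=
  {p | (p.2.Monic ∧ p.2.natDegree = m) ∧ p.1.degree < m}

/-- The coprime pairs `(A, B)` of polynomials with `B` monic of degree `m` and `deg A < m`. -/
def coprimePairs (K : Type*) [Field K] (m : ℕ) : Set (K[X] × K[X]) :=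
  {p | p ∈ properPairs K m ∧ IsCoprime p.1 p.2}

/-- The triples `(G, A, B)` with `(A, B)` a coprime proper pair, `G` monic and `deg (G * B) = m`. -/
def gcdTriples (K : Type*) [Field K] (m : ℕ) : Set (K[X] × K[X] × K[X]) :=
  {x | x.1.Monic ∧ x.2 ∈ coprimePairs K x.2.2.natDegree ∧ x.1.natDegree + x.2.2.natDegree = m}

theorem exists_monic_mul_isCoprime (A : K[X]) {B : K[X]} (hB : B ≠ 0) :
    ∃ G A' B' : K[X], G.Monic ∧ IsCoprime A' B' ∧ A = G * A' ∧ B = G * B' := by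
  classical
  obtain ⟨A', B', hA, hB', hu⟩ := extract_gcd A B
  have hG : gcd A B ≠ 0 := fun h => hB (by rw [hB', h, zero_mul])
  refine ⟨gcd A B, A', B', ?_, ?_, hA, hB'⟩
  · have := monic_normalize hG
    rwa [normalize_gcd] at this
  · exact (gcd_isUnit_iff _ _).1 hu

theorem eq_of_mul_eq_mul_of_isCoprime {U W U' W' : K[X]} (h : IsCoprime U W)
    (h' : IsCoprime U' W') (hW : W.Monic) (hW' : W'.Monic) (he : U * W' = U' * W) :
    W = W' ∧ U = U' := by
  have h1 : W ∣ W' := h.symm.dvd_of_dvd_mul_left (Dvd.intro_left _ he.symm)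
  have h2 : W' ∣ W := h'.symm.dvd_of_dvd_mul_left (Dvd.intro_left _ he)
  have h3 : W = W' := eq_of_monic_of_associated hW hW' (associated_of_dvd_dvd h1 h2)
  subst h3
  exact ⟨rfl, mul_right_cancel₀ hW.ne_zero he⟩

theorem bijOn_gcdTriples_properPairs (m : ℕ) :
    Set.BijOn (fun x : K[X] × K[X] × K[X] => (x.1 * x.2.1, x.1 * x.2.2))
      (gcdTriples K m) (properPairs K m) := by
  refine ⟨?_, ?_, ?_⟩
  · rintro ⟨G, A, B⟩ ⟨hG, ⟨⟨⟨hB, -⟩, hA⟩, -⟩, hd⟩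
    dsimp only at *
    refine ⟨⟨hG.mul hB, by rw [hG.natDegree_mul hB, hd]⟩, ?_⟩
    change (G * A).degree < _
    rw [degree_mul, degree_eq_natDegree hG.ne_zero, ← hd, Nat.cast_add]
    exact WithBot.add_lt_add_left (by simp) hA
  · rintro ⟨G, A, B⟩ ⟨hG, ⟨⟨⟨hB, -⟩, -⟩, hc⟩, -⟩ ⟨G', A', B'⟩ ⟨hG', ⟨⟨⟨hB', -⟩, -⟩, hc'⟩, -⟩ he
    simp only [Prod.mk.injEq] at he hG hB hc hG' hB' hc' ⊢
    have := eq_of_mul_eq_mul_of_isCoprime hc hc' hB hB' (by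
      apply mul_left_cancel₀ (mul_ne_zero hG.ne_zero hG'.ne_zero)
      linear_combination (G' * B') * he.1 - (G' * A') * he.2)
    obtain ⟨rfl, rfl⟩ := this
    exact ⟨mul_right_cancel₀ hB.ne_zero he.2, rfl, rfl⟩
  · rintro ⟨A, B⟩ ⟨⟨hB, hd⟩, hA⟩
    dsimp only at *
    obtain ⟨G, A', B', hG, hc, rfl, rfl⟩ := exists_monic_mul_isCoprime A hB.ne_zero
    have hB' : B'.Monic := hG.of_mul_monic_left hB
    refine ⟨(G, A', B'), ⟨hG, ⟨⟨⟨hB', rfl⟩, ?_⟩, hc⟩, ?_⟩, rfl⟩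
    · rw [hG.natDegree_mul hB'] at hd
      rw [degree_mul, degree_eq_natDegree hG.ne_zero, ← hd, Nat.cast_add] at hA
      exact lt_of_add_lt_add_left hA
    · rw [← hd, hG.natDegree_mul hB']

theorem ncard_properPairs [Finite K] (m : ℕ) :
    (properPairs K m).ncard = Nat.card K ^ (2 * m) := by
  have h : properPairs K m =
      ((degreeLT K m : Submodule K K[X]) : Set K[X]) ×ˢ {p : K[X] | p.Monic ∧ p.natDegree = m} := by
    ext ⟨A, B⟩
    simp [properPairs, mem_degreeLT, and_comm]
  have h1 : Nat.card (degreeLT K m) = Nat.card K ^ m := by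
    rw [Nat.card_congr (degreeLTEquiv K m).toEquiv, Nat.card_fun, Nat.card_fin]
  have h2 : Set.ncard {p : K[X] | p.Monic ∧ p.natDegree = m} = Nat.card K ^ m := by
    rw [← h1, ← Nat.card_congr (monicEquivDegreeLT (R := K) m)]
    rfl
  rw [h, Set.ncard_prod, h2, ← Nat.card_coe_set_eq, SetLike.coe_sort_coe, h1, two_mul, pow_add]

theorem ncard_coprimePairs_succ [Finite K] (m : ℕ) :
    (coprimePairs K (m + 1)).ncard + Nat.card K ^ (2 * m + 1) = Nat.card K ^ (2 * m + 2) := by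
  have hcard (j : ℕ) : (gcdTriples K j).ncard = Nat.card K ^ (2 * j) := by
    rw [← ncard_properPairs, ← (bijOn_gcdTriples_properPairs j).image_eq,
      (bijOn_gcdTriples_properPairs j).injOn.ncard_image]
  have hfin : (gcdTriples K (m + 1)).Finite :=
    Set.finite_of_ncard_ne_zero (by rw [hcard]; exact pow_ne_zero _ Nat.card_pos.ne')
  have hsplit : gcdTriples K (m + 1) = (fun p => (1, p)) '' coprimePairs K (m + 1) ∪
      (fun x : K × K[X] × K[X] × K[X] => (x.2.1 * X + C x.1, x.2.2)) ''
        (Set.univ ×ˢ gcdTriples K m) := by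
    ext ⟨G, A, B⟩
    simp only [Set.mem_union, Set.mem_image, Prod.mk.injEq]
    constructor
    · rintro ⟨hG, hc, hd⟩
      dsimp only at *
      by_cases h0 : G.natDegree = 0
      · left
        rw [h0, zero_add] at hd
        exact ⟨(A, B), hd ▸ hc, (eq_one_of_monic_natDegree_zero hG h0).symm, rfl⟩
      · right
        have hn := natDegree_divX_eq_natDegree_tsub_one (p := G)
        refine ⟨(G.coeff 0, G.divX, A, B), ⟨trivial, ?_, hc, ?_⟩, divX_mul_X_add G, rfl⟩
        · change G.divX.coeff _ = 1
          rw [hn, coeff_divX, Nat.sub_add_cancel (by omega)]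
          exact hG
        · dsimp only
          omega
    · rintro (⟨p, hp, rfl, rfl⟩ | ⟨⟨c, G', p⟩, ⟨-, hG', hp, hd⟩, rfl, rfl⟩)
      · have := hp.1.1.2
        dsimp only at this
        refine ⟨monic_one, ?_, ?_⟩
        · dsimp only
          rwa [this]
        · simp [this]
      · dsimp only at *
        have hdeg : (C c).degree < (G' * X).degree := by
          rw [degree_mul, degree_X, degree_eq_natDegree hG'.ne_zero]
          exact degree_C_le.trans_lt (by exact_mod_cast Nat.succ_pos _)
        refine ⟨(hG'.mul monic_X).add_of_left hdeg, hp, ?_⟩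
        change (G' * X + C c).natDegree + _ = _
        rw [natDegree_add_C, hG'.natDegree_mul monic_X, natDegree_X, ← hd]
        dsimp only
        ring
  have hdisj : Disjoint ((fun p => ((1 : K[X]), p)) '' coprimePairs K (m + 1))
      ((fun x : K × K[X] × K[X] × K[X] => (x.2.1 * X + C x.1, x.2.2)) ''
        (Set.univ ×ˢ gcdTriples K m)) := by
    rw [Set.disjoint_left]
    rintro _ ⟨p, hp, rfl⟩ ⟨⟨c, G', p'⟩, ⟨-, hG', -⟩, he⟩
    simp only [Prod.mk.injEq] at he hG'
    have := congrArg natDegree he.1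
    rw [natDegree_add_C, hG'.natDegree_mul monic_X, natDegree_X, natDegree_one] at this
    omega
  have hinj : Function.Injective
      (fun x : K × K[X] × K[X] × K[X] => (x.2.1 * X + C x.1, x.2.2)) := by
    rintro ⟨c, G, p⟩ ⟨c', G', p'⟩ he
    simp only [Prod.mk.injEq] at he ⊢
    have h0 : c = c' := by simpa using congrArg (fun f => coeff f 0) he.1
    subst h0
    exact ⟨rfl, mul_right_cancel₀ X_ne_zero (add_right_cancel he.1), he.2⟩
  have hf := hsplit ▸ hfin
  have key := congrArg Set.ncard hsplit
  rw [Set.ncard_union_eq hdisj (hf.subset Set.subset_union_left)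
    (hf.subset Set.subset_union_right), Set.ncard_image_of_injective _ hinj,
    Set.ncard_image_of_injective _ (Prod.mk_right_injective _), Set.ncard_prod, hcard, hcard,
    Set.ncard_univ] at key
  rw [show 2 * m + 2 = 2 * (m + 1) by ring, key, pow_succ, mul_comm (Nat.card K)]

variable {F : Type*} [Field F] [Algebra K F]

/-- Evaluation at `lam` is injective on polynomials of degree at most `N`. -/
def EvalInjective (K : Type*) [Field K] [Algebra K F] (lam : F) (N : ℕ) : Prop :=
  ∀ P : K[X], P.natDegree ≤ N → aeval lam P = 0 → P = 0

theorem EvalInjective.mono {lam : F} {M N : ℕ} (h : EvalInjective K lam N) (hMN : M ≤ N) :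
    EvalInjective K lam M := fun P hP h0 => h P (hP.trans hMN) h0

theorem EvalInjective.eq {lam : F} {N : ℕ} (h : EvalInjective K lam N) {P Q : K[X]}
    (hP : P.natDegree ≤ N) (hQ : Q.natDegree ≤ N) (he : aeval lam P = aeval lam Q) : P = Q :=
  sub_eq_zero.1 (h _ ((natDegree_sub_le_of_le hP hQ).trans (max_self N).le) (by rw [map_sub, he, sub_self]))

/-- The nonzero quotients `P(lam) / Q(lam)` of polynomials of degree at most `m` whose coefficients
in degree `m` lie in the subfield `R`. -/
def fractions (lam : F) (R : Subfield K) (m : ℕ) : Set F :=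
  {α | α ≠ 0 ∧ ∃ P Q : K[X], P.natDegree ≤ m ∧ Q.natDegree ≤ m ∧ P.coeff m ∈ R ∧ Q.coeff m ∈ R ∧
    aeval lam Q ≠ 0 ∧ α * aeval lam Q = aeval lam P}

/-- The numerator and denominator of the rational function with value `r` at infinity attached to
a proper fraction `A / B`. -/
noncomputable def fracPair : Option K × K[X] × K[X] → K[X] × K[X]
  | (some r, A, B) => (A + C r * B, B)
  | (none, A, B) => (B, A)

/-- The value at `lam` of the fraction `fracPair x`. -/
noncomputable def fracVal (lam : F) (x : Option K × K[X] × K[X]) : F :=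
  aeval lam (fracPair x).1 / aeval lam (fracPair x).2

/-- The points of the projective line over `K` that are rational over the subfield `R`. -/
def projPoints (R : Subfield K) : Set (Option K) := {o | ∀ r ∈ o, r ∈ R}

theorem ncard_projPoints [Finite K] (R : Subfield K) :
    (projPoints R).ncard = Nat.card R + 1 := by
  have h : projPoints R = insert none (some '' (R : Set K)) := by
    ext o
    cases o <;> simp [projPoints]
  rw [h, Set.ncard_insert_of_notMem (by simp), Set.ncard_image_of_injective _
    (Option.some_injective K), ← Nat.card_coe_set_eq, SetLike.coe_sort_coe]

theorem fracPair_spec {R : Subfield K} {m : ℕ} {x : Option K × K[X] × K[X]}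
    (hx : x ∈ projPoints R ×ˢ coprimePairs K m) :
    IsCoprime (fracPair x).1 (fracPair x).2 ∧
      (fracPair x).1.natDegree ≤ m ∧ (fracPair x).2.natDegree ≤ m ∧
      (fracPair x).1.coeff m ∈ R ∧ (fracPair x).2.coeff m ∈ R ∧
      ((fracPair x).1.coeff m = 1 ∨ (fracPair x).2.coeff m = 1) := by
  obtain ⟨o, A, B⟩ := x
  obtain ⟨ho, ⟨⟨hB, hd⟩, hA⟩, hc⟩ := hx
  dsimp only at *
  have hA0 : A.coeff m = 0 := coeff_eq_zero_of_degree_lt hA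
  have hB1 : B.coeff m = 1 := by rw [← hd]; exact hB
  have hAm : A.natDegree ≤ m := natDegree_le_of_degree_le hA.le
  cases o with
  | none =>
    simp only [fracPair, hA0, hB1]
    exact ⟨hc.symm, hd.le, hAm, R.one_mem, R.zero_mem, Or.inl trivial⟩
  | some r =>
    simp only [fracPair, coeff_add, coeff_C_mul, hA0, hB1, zero_add, mul_one]
    refine ⟨hc.add_mul_right_left _, ?_, hd.le, ho r rfl, R.one_mem, Or.inr trivial⟩
    exact natDegree_add_le_of_degree_le hAm ((natDegree_C_mul_le _ _).trans hd.le)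

theorem ne_zero_of_isCoprime_of_coeff {m : ℕ} (hm : 1 ≤ m) {U W : K[X]} (h : IsCoprime U W)
    (h1 : U.coeff m = 1 ∨ W.coeff m = 1) : U ≠ 0 := by
  rintro rfl
  have hu := natDegree_eq_zero_of_isUnit (isCoprime_zero_left.1 h)
  rcases h1 with h1 | h1
  · simp at h1
  · have := le_natDegree_of_ne_zero (h1.trans_ne one_ne_zero)
    omega

theorem mul_eq_mul_of_eval {lam : F} {m : ℕ} (hN : EvalInjective K lam (2 * m))
    {P Q U W : K[X]} (hP : P.natDegree ≤ m) (hQ : Q.natDegree ≤ m) (hU : U.natDegree ≤ m)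
    (hW : W.natDegree ≤ m) {α : F} (h1 : α * aeval lam Q = aeval lam P)
    (h2 : α * aeval lam W = aeval lam U) : P * W = U * Q := by
  refine hN.eq ?_ ?_ ?_
  · exact natDegree_mul_le.trans (by omega)
  · exact natDegree_mul_le.trans (by omega)
  · rw [map_mul, map_mul, ← h1, ← h2]
    ring

theorem fracVal_spec {lam : F} {m : ℕ} (hN : EvalInjective K lam (2 * m)) (hm : 1 ≤ m)
    {R : Subfield K} {x : Option K × K[X] × K[X]} (hx : x ∈ projPoints R ×ˢ coprimePairs K m) :
    fracVal lam x ≠ 0 ∧ aeval lam (fracPair x).2 ≠ 0 ∧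
      fracVal lam x * aeval lam (fracPair x).2 = aeval lam (fracPair x).1 := by
  obtain ⟨hc, h1, h2, -, -, h5⟩ := fracPair_spec hx
  have hU : aeval lam (fracPair x).1 ≠ 0 := fun h =>
    ne_zero_of_isCoprime_of_coeff hm hc h5 (hN _ (by omega) h)
  have hW : aeval lam (fracPair x).2 ≠ 0 := fun h =>
    ne_zero_of_isCoprime_of_coeff hm hc.symm h5.symm (hN _ (by omega) h)
  exact ⟨div_ne_zero hU hW, hW, div_mul_cancel₀ _ hW⟩

theorem injOn_fracVal {lam : F} {m : ℕ} (hN : EvalInjective K lam (2 * m)) (hm : 1 ≤ m)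
    (R : Subfield K) : Set.InjOn (fracVal lam) (projPoints R ×ˢ coprimePairs K m) := by
  intro x hx y hy he
  obtain ⟨hc, h1, h2, -, -, -⟩ := fracPair_spec hx
  obtain ⟨hc', h1', h2', -, -, -⟩ := fracPair_spec hy
  have e := mul_eq_mul_of_eval hN h1 h2 h1' h2' (fracVal_spec hN hm hx).2.2
    (he ▸ (fracVal_spec hN hm hy).2.2)
  have hne := (fracVal_spec hN hm hx).2.1
  obtain ⟨o, A, B⟩ := x
  obtain ⟨o', A', B'⟩ := y
  obtain ⟨-, ⟨⟨hB, hd⟩, hA⟩, hcp⟩ := hx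
  obtain ⟨-, ⟨⟨hB', hd'⟩, hA'⟩, hcp'⟩ := hy
  dsimp only at *
  have hlt {A B : K[X]} (hB : B.Monic) (hd : B.natDegree = m) (hA : A.degree < m)
      (hdvd : B ∣ A) : A = 0 := by
    refine eq_zero_of_dvd_of_degree_lt hdvd ?_
    rwa [degree_eq_natDegree hB.ne_zero, hd]
  have hA0 {A B : K[X]} (hcp : IsCoprime A B) (hB : B.Monic) (hd : B.natDegree = m) : A ≠ 0 :=
    ne_zero_of_isCoprime_of_coeff hm hcp (Or.inr (by rw [← hd]; exact hB))
  cases o with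
  | none =>
    cases o' with
    | none =>
      simp only [fracPair] at e
      obtain ⟨rfl, rfl⟩ := eq_of_mul_eq_mul_of_isCoprime hcp hcp' hB hB'
        (by linear_combination -e)
      rfl
    | some r =>
      simp only [fracPair] at e hc hc'
      exact absurd (hlt hB' hd' hA (hc'.symm.dvd_of_dvd_mul_left (Dvd.intro_left _ e)))
        (hA0 hcp hB hd)
  | some r =>
    cases o' with
    | none =>
      simp only [fracPair] at e hc hc'
      exact absurd (hlt hB hd hA' (hc.symm.dvd_of_dvd_mul_left (Dvd.intro_left _ e.symm)))
        (hA0 hcp' hB' hd')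
    | some r' =>
      simp only [fracPair] at e hc hc'
      obtain ⟨rfl, h⟩ := eq_of_mul_eq_mul_of_isCoprime hc hc' hB hB' e
      have hr := congrArg (fun f => coeff f m) h
      have hB1 : B.coeff m = 1 := by rw [← hd]; exact hB
      simp only [coeff_add, coeff_C_mul, hB1, coeff_eq_zero_of_degree_lt hA,
        coeff_eq_zero_of_degree_lt hA', zero_add, mul_one] at hr
      subst hr
      rw [add_right_cancel h]

theorem disjoint_fractions_fracVal {lam : F} {m : ℕ} (hN : EvalInjective K lam (2 * (m + 1)))
    (R : Subfield K) : Disjoint (fractions lam (⊤ : Subfield K) m)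
      (fracVal lam '' (projPoints R ×ˢ coprimePairs K (m + 1))) := by
  rw [Set.disjoint_left]
  rintro _ ⟨h0, P, Q, hP, hQ, -, -, hQ0, he⟩ ⟨x, hx, rfl⟩
  obtain ⟨hc, h1, h2, -, -, h5⟩ := fracPair_spec hx
  have e := mul_eq_mul_of_eval hN (hP.trans m.le_succ) (hQ.trans m.le_succ) h1 h2 he
    (fracVal_spec hN (by omega) hx).2.2
  have hPne : P ≠ 0 := by
    rintro rfl
    simp [h0, hQ0] at he
  have hQne : Q ≠ 0 := by
    rintro rfl
    simp at hQ0
  rcases h5 with h5 | h5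
  · have := natDegree_le_of_dvd (hc.dvd_of_dvd_mul_right (Dvd.intro _ e.symm)) hPne
    have := le_natDegree_of_ne_zero (h5.trans_ne one_ne_zero)
    omega
  · have := natDegree_le_of_dvd (hc.symm.dvd_of_dvd_mul_left (Dvd.intro_left _ e)) hQne
    have := le_natDegree_of_ne_zero (h5.trans_ne one_ne_zero)
    omega

theorem mem_fracVal_image {lam : F} {m : ℕ} {R : Subfield K} {P Q : K[X]}
    (hP : P.natDegree ≤ m) (hQ : Q.natDegree ≤ m) (hPR : P.coeff m ∈ R) (hQR : Q.coeff m ∈ R)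
    (hc : IsCoprime P Q) (h0 : P.coeff m ≠ 0 ∨ Q.coeff m ≠ 0) :
    aeval lam P / aeval lam Q ∈ fracVal lam '' (projPoints R ×ˢ coprimePairs K m) := by
  have hmonic {B : K[X]} (hB : B.natDegree ≤ m) (hb : B.coeff m ≠ 0) :
      (C (B.coeff m)⁻¹ * B).Monic ∧ (C (B.coeff m)⁻¹ * B).natDegree = m := by
    have hd : B.natDegree = m := le_antisymm hB (le_natDegree_of_ne_zero hb)
    refine ⟨?_, by rw [natDegree_C_mul (inv_ne_zero hb), hd]⟩
    refine monic_C_mul_of_mul_leadingCoeff_eq_one ?_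
    rw [leadingCoeff, hd, inv_mul_cancel₀ hb]
  have hdeg {A : K[X]} (hA : A.natDegree ≤ m) (ha : A.coeff m = 0) : A.degree < m := by
    refine lt_of_le_of_ne (natDegree_le_iff_degree_le.1 hA) fun h => ?_
    exact coeff_ne_zero_of_eq_degree h ha
  have hunit {b : K} (hb : b ≠ 0) : IsUnit (C b⁻¹ : K[X]) :=
    isUnit_C.2 (isUnit_iff_ne_zero.2 (inv_ne_zero hb))
  by_cases hq : Q.coeff m = 0
  · have hp : P.coeff m ≠ 0 := h0.resolve_right (not_not.2 hq)
    have hs : algebraMap K F (P.coeff m)⁻¹ ≠ 0 :=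
      (_root_.map_ne_zero _).2 (inv_ne_zero hp)
    refine ⟨(none, C (P.coeff m)⁻¹ * Q, C (P.coeff m)⁻¹ * P),
      ⟨by simp [projPoints], ⟨hmonic hP hp, ?_⟩, ?_⟩, ?_⟩
    · exact hdeg ((natDegree_C_mul_le _ _).trans hQ) (by simp [hq])
    · exact (isCoprime_mul_unit_left (hunit hp) _ _).2 hc.symm
    · simp only [fracVal, fracPair, map_mul, aeval_C]
      rw [mul_div_mul_left _ _ hs]
  · have hs : algebraMap K F (Q.coeff m)⁻¹ ≠ 0 :=
      (_root_.map_ne_zero _).2 (inv_ne_zero hq)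
    refine ⟨(some (P.coeff m / Q.coeff m),
      C (Q.coeff m)⁻¹ * P + C (-(P.coeff m / Q.coeff m)) * (C (Q.coeff m)⁻¹ * Q),
      C (Q.coeff m)⁻¹ * Q), ⟨?_, ⟨hmonic hQ hq, ?_⟩, ?_⟩, ?_⟩
    · simpa [projPoints] using R.div_mem hPR hQR
    · refine hdeg (natDegree_add_le_of_degree_le ((natDegree_C_mul_le _ _).trans hP)
        ((natDegree_C_mul_le _ _).trans ((natDegree_C_mul_le _ _).trans hQ))) ?_
      simp only [coeff_add, coeff_C_mul]
      field_simp
      ring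
    · exact ((isCoprime_mul_unit_left (hunit hq) _ _).2 hc).add_mul_right_left _
    · simp only [fracVal, fracPair]
      rw [add_assoc, ← add_mul, ← C_add, neg_add_cancel, C_0, zero_mul, add_zero, map_mul, map_mul,
        aeval_C, mul_div_mul_left _ _ hs]

theorem fractions_succ {lam : F} {m : ℕ} (hN : EvalInjective K lam (2 * (m + 1)))
    (R : Subfield K) : fractions lam R (m + 1) = fractions lam (⊤ : Subfield K) m ∪
      fracVal lam '' (projPoints R ×ˢ coprimePairs K (m + 1)) := by
  have htop {P Q : K[X]} {α : F} (h0 : α ≠ 0) (hP : P.natDegree ≤ m) (hQ : Q.natDegree ≤ m)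
      (hQ0 : aeval lam Q ≠ 0) (he : α * aeval lam Q = aeval lam P) :
      α ∈ fractions lam (⊤ : Subfield K) m :=
    ⟨h0, P, Q, hP, hQ, Subfield.mem_top _, Subfield.mem_top _, hQ0, he⟩
  ext α
  constructor
  · rintro ⟨h0, P, Q, hP, hQ, hPR, hQR, hQ0, he⟩
    have hQne : Q ≠ 0 := by
      rintro rfl
      simp at hQ0
    have hPne : P ≠ 0 := by
      rintro rfl
      simp [h0, hQ0] at he
    obtain ⟨G, A, B, hG, hc, rfl, rfl⟩ := exists_monic_mul_isCoprime P hQne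
    by_cases hd : G.natDegree = 0
    · obtain rfl := eq_one_of_monic_natDegree_zero hG hd
      simp only [one_mul] at *
      by_cases h1 : A.natDegree ≤ m ∧ B.natDegree ≤ m
      · exact Or.inl (htop h0 h1.1 h1.2 hQ0 he)
      · right
        rw [← eq_div_iff hQ0] at he
        rw [he]
        refine mem_fracVal_image hP hQ hPR hQR hc ?_
        by_contra! hcon
        have hlow {D : K[X]} (hD : D.natDegree ≤ m + 1) (hz : D.coeff (m + 1) = 0) :
            D.natDegree ≤ m := by
          by_contra hlt
          have : D.natDegree = m + 1 := by omega
          rw [← this, coeff_natDegree, leadingCoeff_eq_zero] at hz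
          simp [hz] at this
        exact h1 ⟨hlow hP hcon.1, hlow hQ hcon.2⟩
    · left
      rw [natDegree_mul hG.ne_zero (right_ne_zero_of_mul hPne)] at hP
      rw [natDegree_mul hG.ne_zero (right_ne_zero_of_mul hQne)] at hQ
      rw [map_mul] at hQ0
      refine htop h0 (P := A) (Q := B) (by omega) (by omega) (right_ne_zero_of_mul hQ0) ?_
      apply mul_left_cancel₀ (left_ne_zero_of_mul hQ0)
      rw [map_mul, map_mul] at he
      linear_combination he
  · rintro (⟨h0, P, Q, hP, hQ, -, -, hQ0, he⟩ | ⟨x, hx, rfl⟩)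
    · refine ⟨h0, P, Q, hP.trans m.le_succ, hQ.trans m.le_succ, ?_, ?_, hQ0, he⟩
      · rw [coeff_eq_zero_of_natDegree_lt (by omega)]
        exact R.zero_mem
      · rw [coeff_eq_zero_of_natDegree_lt (by omega)]
        exact R.zero_mem
    · obtain ⟨-, h1, h2, h3, h4, -⟩ := fracPair_spec hx
      obtain ⟨g1, g2, g3⟩ := fracVal_spec hN (by omega) hx
      exact ⟨g1, _, _, h1, h2, h3, h4, g2, g3⟩

theorem fractions_zero (lam : F) :
    fractions lam (⊤ : Subfield K) 0 = algebraMap K F '' {0}ᶜ := by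
  ext α
  constructor
  · rintro ⟨h0, P, Q, hP, hQ, -, -, hQ0, he⟩
    rw [eq_C_of_natDegree_le_zero hP, eq_C_of_natDegree_le_zero hQ, aeval_C, aeval_C] at he
    rw [eq_C_of_natDegree_le_zero hQ, aeval_C] at hQ0
    have hα : algebraMap K F (P.coeff 0 / Q.coeff 0) = α := by
      rw [map_div₀, ← he, mul_div_cancel_right₀ _ hQ0]
    refine ⟨_, fun h => h0 ?_, hα⟩
    rw [← hα, Set.mem_singleton_iff.1 h, map_zero]
  · rintro ⟨c, hc, rfl⟩
    exact ⟨(_root_.map_ne_zero _).2 hc, C c, 1, by simp, by simp, Subfield.mem_top _, Subfield.mem_top _,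
      by simp, by simp⟩

theorem ncard_fractions_succ_of_top [Finite K] [Finite F] {lam : F} {m : ℕ}
    (hN : EvalInjective K lam (2 * (m + 1))) (R : Subfield K) :
    (fractions lam R (m + 1)).ncard = (fractions lam (⊤ : Subfield K) m).ncard +
      (Nat.card R + 1) * (coprimePairs K (m + 1)).ncard := by
  rw [fractions_succ hN, Set.ncard_union_eq (disjoint_fractions_fracVal hN R) (Set.toFinite _)
    (Set.toFinite _), (injOn_fracVal hN (by omega) R).ncard_image, Set.ncard_prod,
    ncard_projPoints]

theorem ncard_fractions_top [Finite K] [Finite F] {lam : F} (m : ℕ)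
    (hN : EvalInjective K lam (2 * m)) :
    (fractions lam (⊤ : Subfield K) m).ncard + 1 = Nat.card K ^ (2 * m + 1) := by
  induction m with
  | zero =>
    have := Set.ncard_add_ncard_compl ({0} : Set K)
    rw [Set.ncard_singleton] at this
    rw [fractions_zero, Set.ncard_image_of_injective _ (algebraMap K F).injective, add_comm, this]
    simp
  | succ m ih =>
    have h1 := ih (hN.mono (by omega))
    have h2 := ncard_coprimePairs_succ (K := K) m
    have h3 : Nat.card (⊤ : Subfield K) = Nat.card K :=
      Nat.card_congr Subfield.topEquiv.toEquiv
    rw [ncard_fractions_succ_of_top hN, h3, show 2 * (m + 1) + 1 = 2 * m + 1 + 2 by ring]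
    rw [pow_succ _ (2 * m + 1)] at h2
    rw [pow_add _ (2 * m + 1)]
    zify at *
    linear_combination h1 + ((Nat.card K : ℤ) + 1) * h2

/-- The number of fractions of degree at most `m + 1` with leading coefficients in `R`. -/
theorem ncard_fractions_succ [Finite K] [Finite F] {lam : F} {m : ℕ}
    (hN : EvalInjective K lam (2 * (m + 1))) (R : Subfield K) :
    ((fractions lam R (m + 1)).ncard : ℚ) = (Nat.card K : ℚ) ^ (2 * m + 1) - 1 +
      ((Nat.card R : ℚ) + 1) *
        ((Nat.card K : ℚ) ^ (2 * m + 2) - (Nat.card K : ℚ) ^ (2 * m + 1)) := by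
  have h1 := ncard_fractions_top m (hN.mono (by omega) : EvalInjective K lam (2 * m))
  have h2 := ncard_coprimePairs_succ (K := K) m
  have h3 := ncard_fractions_succ_of_top hN R
  apply_fun (Nat.cast : ℕ → ℚ) at h1 h2 h3
  push_cast at h1 h2 h3
  linear_combination h3 + h1 + ((Nat.card R : ℚ) + 1) * h2

theorem mem_of_mul_X_pow_eq {R : Subfield K} {l : ℕ} (hl : 1 ≤ l) {P Q : K[X]}
    (hQ : Q.natDegree ≤ l) (hPR : P.coeff l ∈ R) (hQR : Q.coeff l ∈ R) (hQ0 : Q ≠ 0) {c r : K}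
    (hc : c ≠ 0) (hr : r ≠ 0) (e : P * X ^ l = C r * (X ^ l + C c) * Q) : r ∈ R := by
  have hcop : IsCoprime (X ^ l) (C r * (X ^ l + C c)) := by
    have hu : IsUnit (C r * C c) := by
      rw [← C_mul, isUnit_C, isUnit_iff_ne_zero]
      exact mul_ne_zero hr hc
    have : IsCoprime (X ^ l) (C r * C c + X ^ l * C r) :=
      (isCoprime_one_right.of_isCoprime_of_dvd_right hu.dvd).add_mul_left_right _
    rwa [show C r * (X ^ l + C c) = C r * C c + X ^ l * C r by ring]
  obtain ⟨D, rfl⟩ := hcop.dvd_of_dvd_mul_left (Dvd.intro_left _ e)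
  have hD0 : D ≠ 0 := right_ne_zero_of_mul hQ0
  have hD : D.natDegree ≤ 0 := by
    rw [mul_comm, natDegree_mul_X_pow _ hD0] at hQ
    omega
  obtain ⟨d, rfl⟩ : ∃ d, D = C d := ⟨_, eq_C_of_natDegree_le_zero hD⟩
  have hP : P = C r * (X ^ l + C c) * C d := by
    apply mul_right_cancel₀ (pow_ne_zero l X_ne_zero)
    rw [e]
    ring
  have hd0 : d ≠ 0 := fun h => hD0 (by rw [h, C_0])
  rw [coeff_mul_C, coeff_X_pow_self, one_mul] at hQR
  rw [hP, coeff_mul_C, coeff_C_mul, coeff_add, coeff_X_pow_self, coeff_C, if_neg (by omega),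
    add_zero, mul_one] at hPR
  simpa [hd0] using R.div_mem hPR hQR

end RationalFractions

section Orbit

variable {F : Type*} [Field F] {Fq Fq2 : Subfield F} {lam : F} {l : ℕ} {S : Submodule Fq F}

/-- `S` consists of the values at `lam` of the polynomials over `Fq2` of degree at most `l` whose
coefficient in degree `l` lies in `Fq`. -/
def IsEvalSpace (Fq2 : Subfield F) (lam : F) (l : ℕ) (S : Submodule Fq F) : Prop :=
  ∀ x, x ∈ S ↔ ∃ P : Fq2[X], P.natDegree ≤ l ∧ P.coeff l ∈ Fq.comap Fq2.subtype ∧ aeval lam P = x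

theorem isEvalSpace_span (hle : Fq ≤ Fq2) (lam : F) (l : ℕ) :
    IsEvalSpace Fq2 lam l (Submodule.span Fq {x : F | ∃ c ∈ Fq2, ∃ j < l, x = c * lam ^ j} ⊔
      Submodule.span Fq {lam ^ l}) := by
  have hmono (c : Fq2) (j : ℕ) : aeval lam (C c * X ^ j) = (c : F) * lam ^ j := by
    rw [map_mul, aeval_C, map_pow, aeval_X]
    rfl
  let T : Submodule Fq F :=
    { carrier := {x | ∃ P : Fq2[X], P.natDegree ≤ l ∧ P.coeff l ∈ Fq.comap Fq2.subtype ∧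
        aeval lam P = x}
      add_mem' := by
        rintro _ _ ⟨P, hP, hPl, rfl⟩ ⟨Q, hQ, hQl, rfl⟩
        exact ⟨P + Q, natDegree_add_le_of_degree_le hP hQ, by
          rw [coeff_add]; exact Subfield.add_mem _ hPl hQl, map_add _ _ _⟩
      zero_mem' := ⟨0, by simp, by simp, map_zero _⟩
      smul_mem' := by
        rintro c _ ⟨P, hP, hPl, rfl⟩
        refine ⟨C ⟨c, hle c.2⟩ * P, (natDegree_C_mul_le _ _).trans hP, ?_, ?_⟩
        · rw [coeff_C_mul]
          exact Subfield.mul_mem _ c.2 hPl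
        · rw [map_mul, aeval_C]
          rfl }
  intro x
  constructor
  · intro hx
    refine (sup_le ?_ ?_ : _ ≤ T) hx
    · rw [Submodule.span_le]
      rintro _ ⟨c, hc, j, hj, rfl⟩
      refine ⟨C ⟨c, hc⟩ * X ^ j, (natDegree_C_mul_X_pow_le _ _).trans hj.le, ?_, hmono _ _⟩
      rw [coeff_C_mul_X_pow, if_neg hj.ne']
      exact Subfield.zero_mem _
    · rw [Submodule.span_le, Set.singleton_subset_iff]
      refine ⟨X ^ l, natDegree_X_pow_le l, ?_, by simp⟩
      rw [coeff_X_pow_self]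
      exact Subfield.one_mem _
  · rintro ⟨P, hP, hPl, rfl⟩
    rw [P.as_sum_range_C_mul_X_pow' (Nat.lt_succ_of_le hP), map_sum]
    refine Submodule.sum_mem _ fun j hj => ?_
    rw [hmono]
    rcases (Nat.lt_succ_iff.1 (Finset.mem_range.1 hj)).lt_or_eq with h | rfl
    · exact Submodule.mem_sup_left (Submodule.subset_span ⟨_, (P.coeff j).2, j, h, rfl⟩)
    · refine Submodule.mem_sup_right (Submodule.mem_span_singleton.2 ⟨⟨_, hPl⟩, rfl⟩)

theorem mem_smulSub {α x : F} : x ∈ smulSub Fq α S ↔ ∃ y ∈ S, α * y = x := by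
  simp [smulSub]

theorem IsEvalSpace.inf_smulSub_eq_bot_iff (hS : IsEvalSpace Fq2 lam l S) {α : F} (hα : α ≠ 0) :
    S ⊓ smulSub Fq α S = ⊥ ↔ α ∉ fractions lam (Fq.comap Fq2.subtype) l := by
  rw [Submodule.eq_bot_iff]
  constructor
  · rintro h ⟨-, P, Q, hP, hQ, hPl, hQl, hQ0, he⟩
    have hPS : aeval lam P ∈ S := (hS _).2 ⟨P, hP, hPl, rfl⟩
    have hQS : aeval lam Q ∈ S := (hS _).2 ⟨Q, hQ, hQl, rfl⟩
    have h0 := h _ ⟨hPS, mem_smulSub.2 ⟨_, hQS, he⟩⟩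
    rw [← he] at h0
    exact mul_ne_zero hα hQ0 h0
  · rintro h x ⟨hx, hx'⟩
    by_contra hx0
    obtain ⟨y, hy, rfl⟩ := mem_smulSub.1 hx'
    obtain ⟨P, hP, hPl, hPe⟩ := (hS _).1 hx
    obtain ⟨Q, hQ, hQl, rfl⟩ := (hS _).1 hy
    exact h ⟨hα, P, Q, hP, hQ, hPl, hQl, right_ne_zero_of_mul hx0, hPe.symm⟩

theorem IsEvalSpace.smulSub_eq_iff (hS : IsEvalSpace Fq2 lam l S)
    (hN : EvalInjective Fq2 lam (2 * l)) (hl : 1 ≤ l) {α β : F} (hα : α ≠ 0) (hβ : β ≠ 0) :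
    smulSub Fq α S = smulSub Fq β S ↔ ∃ c ∈ Fq, α = c * β := by
  constructor
  · intro h
    have hmem {y : F} (hy : y ∈ S) : α / β * y ∈ S := by
      obtain ⟨z, hz, he⟩ := mem_smulSub.1 (h ▸ mem_smulSub.2 ⟨y, hy, rfl⟩ :
        α * y ∈ smulSub Fq β S)
      rwa [div_mul_eq_mul_div, ← he, mul_div_cancel_left₀ _ hβ]
    have h1 : (1 : F) ∈ S := (hS _).2 ⟨1, by simp, by
      rw [coeff_one, if_neg (by omega)]; exact Subfield.zero_mem _, map_one _⟩
    have hX : lam ^ l ∈ S := (hS _).2 ⟨X ^ l, natDegree_X_pow_le l, by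
      rw [coeff_X_pow_self]; exact Subfield.one_mem _, by simp⟩
    obtain ⟨P, hP, -, hPe⟩ := (hS _).1 (hmem h1)
    obtain ⟨Q, hQ, hQl, hQe⟩ := (hS _).1 (hmem hX)
    rw [mul_one] at hPe
    have hPQ : P * X ^ l = Q := by
      refine hN.eq ?_ (by omega) ?_
      · exact natDegree_mul_le.trans (by rw [natDegree_X_pow]; omega)
      · rw [map_mul, hPe, hQe, map_pow, aeval_X]
    have hP0 : P.natDegree ≤ 0 := by
      by_cases hz : P = 0
      · simp [hz]
      · rw [← hPQ, natDegree_mul_X_pow _ hz] at hQ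
        omega
    rw [← hPQ, coeff_mul_X_pow', if_pos le_rfl, Nat.sub_self] at hQl
    refine ⟨(P.coeff 0 : F), hQl, ?_⟩
    rw [eq_C_of_natDegree_le_zero hP0, aeval_C] at hPe
    exact (div_eq_iff hβ).1 hPe.symm
  · rintro ⟨c, hc, rfl⟩
    have hc0 : c ≠ 0 := left_ne_zero_of_mul hα
    ext x
    simp only [mem_smulSub]
    constructor
    · rintro ⟨y, hy, rfl⟩
      exact ⟨c * y, S.smul_mem (⟨c, hc⟩ : Fq) hy, by ring⟩
    · rintro ⟨y, hy, rfl⟩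
      exact ⟨c⁻¹ * y, S.smul_mem (⟨c⁻¹, Fq.inv_mem hc⟩ : Fq) hy, by field_simp⟩

theorem IsEvalSpace.ncard_orbit_mul [Finite F] (hS : IsEvalSpace Fq2 lam l S)
    (hN : EvalInjective Fq2 lam (2 * l)) (hl : 1 ≤ l) :
    Set.ncard {T | T ∈ Orb Fq S ∧ S ⊓ T = ⊥} * (Nat.card Fq - 1) +
      (fractions lam (Fq.comap Fq2.subtype) l).ncard + 1 = Nat.card F := by
  classical
  have := Fintype.ofFinite F
  set A := fractions lam (Fq.comap Fq2.subtype) l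
  let Z : Finset F := Finset.univ.filter fun α => α ≠ 0 ∧ α ∉ A
  have himage : {T | T ∈ Orb Fq S ∧ S ⊓ T = ⊥} = Z.image fun α => smulSub Fq α S := by
    ext T
    simp only [Set.mem_ofPred_eq, Finset.coe_image, Set.mem_image, Finset.mem_coe, Z,
      Finset.mem_filter, Finset.mem_univ, true_and]
    constructor
    · rintro ⟨⟨α, hα, rfl⟩, h⟩
      exact ⟨α, ⟨hα, (hS.inf_smulSub_eq_bot_iff hα).1 h⟩, rfl⟩
    · rintro ⟨α, ⟨hα, h⟩, rfl⟩
      exact ⟨⟨α, hα, rfl⟩, (hS.inf_smulSub_eq_bot_iff hα).2 h⟩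
  have hfiber : ∀ T ∈ Z.image (fun α => smulSub Fq α S),
      (Z.filter fun α => smulSub Fq α S = T).card = Nat.card Fq - 1 := by
    intro T hT
    obtain ⟨β, hβ, rfl⟩ := Finset.mem_image.1 hT
    simp only [Z, Finset.mem_filter, Finset.mem_univ, true_and] at hβ
    have hset : (((Z.filter fun α => smulSub Fq α S = smulSub Fq β S) : Finset F) : Set F) =
        (fun c : F => c * β) '' ((Fq : Set F) \ {0}) := by
      ext α
      simp only [Finset.coe_filter, Z, Finset.mem_filter, Finset.mem_univ, true_and,
        Set.mem_ofPred_eq, Set.mem_image, Set.mem_sdiff, SetLike.mem_coe, Set.mem_singleton_iff]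
      constructor
      · rintro ⟨⟨hα, -⟩, h⟩
        obtain ⟨c, hc, rfl⟩ := (hS.smulSub_eq_iff hN hl hα hβ.1).1 h
        exact ⟨c, ⟨hc, left_ne_zero_of_mul hα⟩, rfl⟩
      · rintro ⟨c, ⟨hc, hc0⟩, rfl⟩
        have hα : c * β ≠ 0 := mul_ne_zero hc0 hβ.1
        have he := (hS.smulSub_eq_iff hN hl hα hβ.1).2 ⟨c, hc, rfl⟩
        refine ⟨⟨hα, ?_⟩, he⟩
        rw [← hS.inf_smulSub_eq_bot_iff hα, he]
        exact (hS.inf_smulSub_eq_bot_iff hβ.1).2 hβ.2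
    rw [← Set.ncard_coe_finset, hset, Set.ncard_image_of_injective _ (mul_left_injective₀ hβ.1),
      Set.ncard_sdiff_singleton_of_mem Fq.zero_mem, ← Nat.card_coe_set_eq, SetLike.coe_sort_coe]
  have hZ : Z.card = Set.ncard {T | T ∈ Orb Fq S ∧ S ⊓ T = ⊥} * (Nat.card Fq - 1) := by
    rw [himage, Set.ncard_coe_finset, Finset.card_eq_sum_card_image (fun α => smulSub Fq α S) Z,
      Finset.sum_const_nat hfiber]
  have hcompl : (Z : Set F)ᶜ = insert 0 A := by
    ext α
    simp only [Z, Finset.coe_filter, Finset.mem_univ, true_and, Set.mem_compl_iff,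
      Set.mem_ofPred_eq, Set.mem_insert_iff]
    tauto
  have h0 : (0 : F) ∉ A := fun h => h.1 rfl
  rw [← hZ, ← Set.ncard_coe_finset, ← Set.ncard_add_ncard_compl (Z : Set F), hcompl,
    Set.ncard_insert_of_notMem h0, add_assoc]

theorem IsEvalSpace.infinite_orbit_of_family (hS : IsEvalSpace Fq2 lam l S)
    (hN : EvalInjective Fq2 lam (2 * l)) (hl : 1 ≤ l) {s : Set F} (hs : s.Infinite) {g : F → F}
    (hg : ∀ c ∈ s, g c ≠ 0 ∧ g c ∉ fractions lam (Fq.comap Fq2.subtype) l)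
    (hinj : ∀ c ∈ s, ∀ c' ∈ s, ∀ e ∈ Fq, g c = e * g c' → c = c') :
    Set.Infinite {T | T ∈ Orb Fq S ∧ S ⊓ T = ⊥} := by
  refine Set.infinite_of_injOn_mapsTo (f := fun c => smulSub Fq (g c) S) (s := s) ?_ ?_ hs
  · intro c hc c' hc' h
    obtain ⟨e, he, h'⟩ := (hS.smulSub_eq_iff hN hl (hg c hc).1 (hg c' hc').1).1 h
    exact hinj c hc c' hc' e he h'
  · intro c hc
    exact ⟨⟨g c, (hg c hc).1, rfl⟩, (hS.inf_smulSub_eq_bot_iff (hg c hc).1).2 (hg c hc).2⟩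

theorem IsEvalSpace.infinite_orbit_of_not_le (hS : IsEvalSpace Fq2 lam l S)
    (hN : EvalInjective Fq2 lam (2 * l)) (hl : 1 ≤ l) (hinf : (Fq : Set F).Infinite)
    (hle : Fq ≤ Fq2) (hlt : ¬ Fq2 ≤ Fq) :
    Set.Infinite {T | T ∈ Orb Fq S ∧ S ⊓ T = ⊥} := by
  obtain ⟨r, hr2, hr⟩ := SetLike.not_le_iff_exists.1 hlt
  have hr0 : r ≠ 0 := fun h => hr (h ▸ Fq.zero_mem)
  have hev (c : F) (hc : c ∈ Fq) : aeval lam (X ^ l + C (⟨c, hle hc⟩ : Fq2)) = lam ^ l + c := by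
    rw [map_add, aeval_C, map_pow, aeval_X]
    rfl
  have hXl : (X ^ l : Fq2[X]).natDegree ≤ l := natDegree_X_pow_le l
  have hXc (c : Fq2) : (X ^ l + C c).natDegree ≤ l := by rw [natDegree_X_pow_add_C]
  have hlam : lam ^ l ≠ 0 := by
    intro h
    exact pow_ne_zero l X_ne_zero (hN (X ^ l) (by omega) (by rw [map_pow, aeval_X, h]))
  have hlamc (c : F) (hc : c ∈ Fq) : lam ^ l + c ≠ 0 := by
    rw [← hev c hc]
    intro h
    exact X_pow_add_C_ne_zero (by omega) _ (hN _ ((hXc _).trans (by omega)) h)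
  refine hS.infinite_orbit_of_family hN hl (hinf.sdiff (Set.finite_singleton 0))
    (g := fun c => r * (lam ^ l + c) / lam ^ l) ?_ ?_
  · rintro c ⟨hc, hc0⟩
    refine ⟨div_ne_zero (mul_ne_zero hr0 (hlamc c hc)) hlam, ?_⟩
    rintro ⟨-, P, Q, hP, hQ, hPl, hQl, hQ0, he⟩
    let r' : Fq2 := ⟨r, hr2⟩
    let c' : Fq2 := ⟨c, hle hc⟩
    have hQne : Q ≠ 0 := by
      rintro rfl
      simp at hQ0
    have hdeg : (C r' * (X ^ l + C c')).natDegree ≤ l := (natDegree_C_mul_le _ _).trans (hXc c')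
    refine hr (mem_of_mul_X_pow_eq hl hQ hPl hQl hQne (c := c') (r := r')
      (fun h => hc0 (congrArg Subtype.val h)) (fun h => hr0 (congrArg Subtype.val h)) ?_)
    refine mul_eq_mul_of_eval hN hP hQ hdeg hXl he ?_
    rw [map_mul, hev c hc, aeval_C, map_pow, aeval_X, div_mul_cancel₀ _ hlam]
    rfl
  · rintro c ⟨hc, -⟩ c' ⟨hc', -⟩ e he h
    have h' : lam ^ l + c = e * (lam ^ l + c') := by
      field_simp at h
      linear_combination h
    have hp : X ^ l + C (⟨c, hle hc⟩ : Fq2) = C (⟨e, hle he⟩ : Fq2) *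
        (X ^ l + C (⟨c', hle hc'⟩ : Fq2)) := by
      refine hN.eq ((hXc _).trans (by omega))
        ((natDegree_C_mul_le _ _).trans ((hXc _).trans (by omega))) ?_
      rw [map_mul, hev c hc, hev c' hc', aeval_C, h']
      rfl
    have h1 := congrArg (fun f : Fq2[X] => ((f.coeff l : Fq2) : F)) hp
    simp only [coeff_add, coeff_X_pow_self, coeff_C_mul, coeff_C, if_neg (by omega : l ≠ 0),
      add_zero, mul_one] at h1
    have h1' : e = 1 := h1.symm
    rw [h1', one_mul] at h'
    exact add_left_cancel h'

theorem IsEvalSpace.infinite_orbit_of_le (hS : IsEvalSpace Fq2 lam l S)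
    (hN : EvalInjective Fq2 lam (2 * l)) (hl : 1 ≤ l) (hinf : (Fq : Set F).Infinite)
    (hle : Fq ≤ Fq2) (hge : Fq2 ≤ Fq)
    (hne : {T | T ∈ Orb Fq S ∧ S ⊓ T = ⊥}.Nonempty) :
    Set.Infinite {T | T ∈ Orb Fq S ∧ S ⊓ T = ⊥} := by
  obtain ⟨_, ⟨α, hα, rfl⟩, h⟩ := hne
  have hαf := (hS.inf_smulSub_eq_bot_iff hα).1 h
  have hR (x : Fq2) : x ∈ Fq.comap Fq2.subtype := hge x.2
  have hαq : α ∉ Fq := by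
    intro hmem
    exact hαf ⟨hα, C ⟨α, hle hmem⟩, 1, by simp, by simp, hR _, hR _, by simp, by
      rw [map_one, mul_one, aeval_C]; rfl⟩
  refine hS.infinite_orbit_of_family hN hl hinf (g := fun c => α + c) ?_ ?_
  · intro c hc
    refine ⟨fun h0 => hαq ?_, ?_⟩
    · rw [eq_neg_of_add_eq_zero_left h0]
      exact Fq.neg_mem hc
    · rintro ⟨-, P, Q, hP, hQ, -, -, hQ0, he⟩
      refine hαf ⟨hα, P - C ⟨c, hle hc⟩ * Q, Q, ?_, hQ, hR _, hR _, hQ0, ?_⟩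
      · exact (natDegree_sub_le_of_le hP ((natDegree_C_mul_le _ _).trans hQ)).trans
          (max_self l).le
      · rw [map_sub, ← he, map_mul, aeval_C]
        change _ = _ - c * _
        ring
  · intro c hc c' hc' e he h
    by_cases he1 : e = 1
    · rw [he1, one_mul] at h
      exact add_left_cancel h
    · refine absurd ?_ hαq
      have h1 : 1 - e ≠ 0 := sub_ne_zero.2 (Ne.symm he1)
      have : α = (e * c' - c) / (1 - e) := by
        rw [eq_div_iff h1]
        linear_combination h
      rw [this]
      exact Fq.div_mem (Fq.sub_mem (Fq.mul_mem he hc') hc) (Fq.sub_mem Fq.one_mem he)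

theorem IsEvalSpace.ncard_orbit_of_infinite (hS : IsEvalSpace Fq2 lam l S)
    (hN : EvalInjective Fq2 lam (2 * l)) (hl : 1 ≤ l) (hinf : (Fq : Set F).Infinite)
    (hle : Fq ≤ Fq2) : Set.ncard {T | T ∈ Orb Fq S ∧ S ⊓ T = ⊥} = 0 := by
  rcases Set.eq_empty_or_nonempty {T | T ∈ Orb Fq S ∧ S ⊓ T = ⊥} with h | h
  · rw [h, Set.ncard_empty]
  · refine Set.Infinite.ncard ?_
    by_cases hge : Fq2 ≤ Fq
    · exact hS.infinite_orbit_of_le hN hl hinf hle hge h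
    · exact hS.infinite_orbit_of_not_le hN hl hinf hle hge

end Orbit

/-- For the second family of FWS codes, the number of subspaces `αS` with
`S ∩ αS = {0}` equals
`(q^n - 1)/(q - 1) - (q+1) - (q+1)q^2((q^{4l-3} - q)(q - 1) + (q+1)(q^{4l} - 1))/(q^4 - 1)`. -/
theorem stmt3 (q n : ℕ) (hn : 0 < n) (hneven : Even n)
    (F : Type*) [Field F] (hF : Nat.card F = q ^ n)
    (Fq Fq2 : Subfield F) (hq : Nat.card Fq = q) (hle : Fq ≤ Fq2)
    (hq2 : Nat.card Fq2 = q ^ 2)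
    (lam : F) (hlam : lam ∉ Fq2)
    (t : ℕ) (ht : t = (minpoly Fq2 lam).natDegree)
    (l : ℕ) (hl : 1 ≤ l) (hlt : 2 * l < t)
    (S : Submodule Fq F)
    (hS : S = Submodule.span Fq {x : F | ∃ c ∈ Fq2, ∃ j < l, x = c * lam ^ j} ⊔
      Submodule.span Fq {lam ^ l}) :
    (Set.ncard {T | T ∈ Orb Fq S ∧ S ⊓ T = ⊥} : ℚ) =
      ((q : ℚ) ^ n - 1) / ((q : ℚ) - 1) - ((q : ℚ) + 1) -
        ((q : ℚ) + 1) * (q : ℚ) ^ 2 *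
          ((((q : ℚ) ^ (4 * l - 3) - (q : ℚ)) * ((q : ℚ) - 1) +
              ((q : ℚ) + 1) * ((q : ℚ) ^ (4 * l) - 1)) / ((q : ℚ) ^ 4 - 1)) := by
  have hN : EvalInjective Fq2 lam (2 * l) := by
    intro P hP h0
    by_contra hne
    have := natDegree_le_natDegree (minpoly.degree_le_of_ne_zero Fq2 lam hne h0)
    omega
  have hES : IsEvalSpace Fq2 lam l S := hS ▸ isEvalSpace_span hle lam l
  rcases Nat.eq_zero_or_pos q with rfl | hqpos
  · have hinf : (Fq : Set F).Infinite := by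
      rcases Nat.card_eq_zero.1 hq with h | h
      · exact (h.false 0).elim
      · exact Set.infinite_coe_iff.1 h
    rw [hES.ncard_orbit_of_infinite hN hl hinf hle]
    simp [hn.ne']
  · have hfin : Finite F := Nat.finite_of_card_ne_zero (by rw [hF]; positivity)
    have hq1 : 1 < q := hq ▸ Finite.one_lt_card
    have hR : Nat.card (Fq.comap Fq2.subtype) = q := by
      rw [← hq]
      exact Nat.card_congr
        { toFun := fun x => ⟨x.1, x.2⟩
          invFun := fun x => ⟨⟨x.1, hle x.2⟩, x.2⟩
          left_inv := fun _ => rfl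
          right_inv := fun _ => rfl }
    have hcount := hES.ncard_orbit_mul hN hl
    obtain ⟨m, rfl⟩ : ∃ m, l = m + 1 := ⟨l - 1, by omega⟩
    have hfrac := ncard_fractions_succ hN (Fq.comap Fq2.subtype)
    rw [hR, hq2] at hfrac
    rw [hq, hF] at hcount
    apply_fun (Nat.cast : ℕ → ℚ) at hcount
    rw [Nat.cast_add, Nat.cast_add, hfrac, Nat.cast_mul, Nat.cast_sub hq1.le] at hcount
    push_cast at hcount
    have hq1' : (1 : ℚ) < q := by exact_mod_cast hq1
    have h1 : (q : ℚ) - 1 ≠ 0 := by linarith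
    have h4 : (q : ℚ) ^ 4 - 1 ≠ 0 := (sub_pos.2 (one_lt_pow₀ hq1' (by norm_num))).ne'
    have hN' : (Set.ncard {T | T ∈ Orb Fq S ∧ S ⊓ T = ⊥} : ℚ) =
        ((q : ℚ) ^ n - 1 - (((q : ℚ) ^ 2) ^ (2 * m + 1) - 1 + ((q : ℚ) + 1) *
          (((q : ℚ) ^ 2) ^ (2 * m + 2) - ((q : ℚ) ^ 2) ^ (2 * m + 1)))) / ((q : ℚ) - 1) := by
      rw [eq_div_iff h1]
      linear_combination hcount
    rw [hN', show 4 * (m + 1) - 3 = 4 * m + 1 by omega]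
    field_simp
    ring
end

section
/- Assume additionally b = 1, so that S = S̄ ⊕ S_m, and assume F_{q^t} ∩ S̄ = {0}. Then for every c ∈ F_{q^t}^* = F_{q^t} \ {0}, one has S ∩ cS = S̄ ⊕ (S_m ∩ cS_m), where S_m = ⟨1, λ, …, λ^{m−1}⟩_{F_q}. -/
open Module

/-- If `B` and `C` lie in a submodule `K` disjoint from `A`, then
`(A ⊔ B) ⊓ (A ⊔ C) = A ⊔ (B ⊓ C)`. -/
theorem Submodule.sup_inf_sup_eq_of_disjoint {R M : Type*} [Ring R] [AddCommGroup M] [Module R M]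
    {A B C K : Submodule R M} (hB : B ≤ K) (hC : C ≤ K) (hAK : Disjoint A K) :
    (A ⊔ B) ⊓ (A ⊔ C) = A ⊔ (B ⊓ C) := by
  refine le_antisymm ?_ (le_inf (sup_le_sup_left inf_le_left _) (sup_le_sup_left inf_le_right _))
  rintro x ⟨hxB, hxC⟩
  obtain ⟨a, ha, b, hb, rfl⟩ := Submodule.mem_sup.1 hxB
  obtain ⟨a', ha', c, hc, hac⟩ := Submodule.mem_sup.1 hxC
  have hsub : b - c = a' - a := by rw [sub_eq_sub_iff_add_eq_add, add_comm b a, ← hac]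
  have hzero : b - c = 0 := Submodule.disjoint_def.1 hAK _
    (hsub ▸ A.sub_mem ha' ha) (K.sub_mem (hB hb) (hC hc))
  rw [sub_eq_zero] at hzero
  exact Submodule.add_mem_sup ha ⟨hb, hzero ▸ hc⟩

theorem smulSub_sup {F : Type*} [Field F] (Fq : Subfield F) (c : F) (A B : Submodule Fq F) :
    smulSub Fq c (A ⊔ B) = smulSub Fq c A ⊔ smulSub Fq c B :=
  Submodule.map_sup _ _ _

/-- A subspace over `Fqt` is invariant under multiplication by nonzero elements of `Fqt`. -/
theorem smulSub_toFqSub {F : Type*} [Field F] {Fq Fqt : Subfield F} (h : Fq ≤ Fqt)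
    (W : Submodule Fqt F) {c : F} (hc : c ∈ Fqt) (hc0 : c ≠ 0) :
    smulSub Fq c (toFqSub Fq Fqt h W) = toFqSub Fq Fqt h W := by
  ext x
  constructor
  · rintro ⟨y, hy, rfl⟩
    exact W.smul_mem (⟨c, hc⟩ : Fqt) hy
  · intro hx
    exact ⟨c⁻¹ * x, W.smul_mem (⟨c⁻¹, Fqt.inv_mem hc⟩ : Fqt) hx, mul_inv_cancel_left₀ hc0 x⟩

theorem smulSub_le_subfieldModule {F : Type*} [Field F] {Fq Fqt : Subfield F} (h : Fq ≤ Fqt)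
    {V : Submodule Fq F} (hV : V ≤ subfieldModule Fq Fqt h) {c : F} (hc : c ∈ Fqt) :
    smulSub Fq c V ≤ subfieldModule Fq Fqt h := by
  rintro _ ⟨y, hy, rfl⟩
  exact Fqt.mul_mem hc (hV hy)

/-- With `b = 1`, so `S = S̄ ⊕ S_m`, and `F_{q^t} ∩ S̄ = {0}`: for every
`c ∈ F_{q^t}^*` one has `S ∩ cS = S̄ ⊕ (S_m ∩ cS_m)`. -/
theorem stmt6 (q n : ℕ) (hn : 0 < n)
    (F : Type*) [Field F] (hF : Nat.card F = q ^ n)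
    (Fq Fqt : Subfield F) (hq : Nat.card Fq = q) (hle : Fq ≤ Fqt)
    (lam : F) (hlam : lam ∉ Fq) (hmem : lam ∈ Fqt)
    (t : ℕ) (ht : t = (minpoly Fq lam).natDegree) (hqt : Nat.card Fqt = q ^ t)
    (l : ℕ) (hl : 0 < l)
    (Sbar : Submodule Fqt F) (hSbar : finrank Fqt Sbar = l)
    (hint : (Fqt : Set F) ∩ (Sbar : Set F) = {0})
    (m : ℕ) (hm1 : 0 < m) (hm2 : m < t)
    (Sm : Submodule Fq F) (hSm : Sm = Submodule.span Fq {x : F | ∃ j < m, x = lam ^ j})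
    (S : Submodule Fq F) (hS : S = toFqSub Fq Fqt hle Sbar ⊔ Sm) :
    ∀ c ∈ Fqt, c ≠ 0 →
      S ⊓ smulSub Fq c S = toFqSub Fq Fqt hle Sbar ⊔ (Sm ⊓ smulSub Fq c Sm) := by
  intro c hc hc0
  have hSmK : Sm ≤ subfieldModule Fq Fqt hle := by
    rw [hSm, Submodule.span_le]
    rintro _ ⟨j, -, rfl⟩
    exact Fqt.pow_mem hmem j
  have hdisj : Disjoint (toFqSub Fq Fqt hle Sbar) (subfieldModule Fq Fqt hle) :=
    Submodule.disjoint_def.2 fun x hxS hxK => hint.subset ⟨hxK, hxS⟩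
  rw [hS, smulSub_sup, smulSub_toFqSub hle Sbar hc hc0]
  exact Submodule.sup_inf_sup_eq_of_disjoint hSmK (smulSub_le_subfieldModule hle hSmK hc) hdisj
end

section
/- Suppose Y = F (so n = t(l+1)) and 2m ≥ t − 1, suppose Orb(S) is an r-FWS code with r = 2m + t(l−1), and let μ ∈ F^* with μ ∉ H(S̄). Then dim_{F_q}(S ∩ μS) = t(l−1) + 2m. -/
open Module

section Helpers

universe u v

/-- The dimension of the preimage of a subspace under a surjective linear map. -/
theorem rank_comap_of_surjective {K : Type v} {M N : Type u} [Field K] [AddCommGroup M]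
    [Module K M] [AddCommGroup N] [Module K N] (g : M →ₗ[K] N) (hg : Function.Surjective g)
    (W : Submodule K N) :
    Module.rank K (W.comap g) = Module.rank K W + Module.rank K (LinearMap.ker g) := by
  let r : W.comap g →ₗ[K] W := g.restrict fun _ hx => hx
  have hr : Function.Surjective r := by
    rintro ⟨w, hw⟩
    obtain ⟨x, rfl⟩ := hg w
    exact ⟨⟨x, hw⟩, rfl⟩
  have hker : LinearMap.ker r = (LinearMap.ker g).comap (W.comap g).subtype := by
    ext x
    simp [r, LinearMap.mem_ker, Subtype.ext_iff]
  have hle : LinearMap.ker g ≤ W.comap g := by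
    intro x hx
    have : g x = 0 := hx
    simp [this]
  rw [LinearMap.rank_eq_of_surjective hr, hker, (Submodule.comapSubtypeEquivOfLe hle).rank_eq]

variable {K : Type v} {L F : Type u} [Field K] [Field L] [Field F] [Algebra K L] [Algebra L F]
  [Algebra K F] [IsScalarTower K L F]

/-- If a nonzero functional `f` and its twist `f (ν * ·)` have different kernels, then the pair
of them is surjective. -/
theorem surjective_prod_mulLeft (f : F →ₗ[L] L) (b : F) (hfb : f b = 1) (ν x : F)
    (hx : f x = 0) (hνx : f (ν * x) ≠ 0) :
    Function.Surjective (f.prod (f ∘ₗ LinearMap.mulLeft L ν)) := by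
  rintro ⟨u, v⟩
  refine ⟨u • b + ((v - u * f (ν * b)) / f (ν * x)) • x, ?_⟩
  apply Prod.ext
  · simp [hfb, hx]
  · simp [mul_add, hνx]

/-- The intersection of the preimages of `V` under `f` and under its twist `f (ν * ·)` has the
same dimension for every twist with a different kernel. -/
theorem rank_comap_inf_comap_mulLeft {l m : ℕ} (hl : 0 < l) (hF : finrank L F = l + 1)
    (f : F →ₗ[L] L) (b : F) (hfb : f b = 1) (ν x : F) (hx : f x = 0) (hνx : f (ν * x) ≠ 0)
    (V : Submodule K L) (hV : Module.rank K V = m) :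
    Module.rank K ↥(V.comap (f.restrictScalars K) ⊓
      (V.comap (f.restrictScalars K)).comap (LinearMap.mulLeft K ν)) =
      ((2 * m : ℕ) : Cardinal) + Module.rank K L * ((l - 1 : ℕ) : Cardinal) := by
  have : FiniteDimensional L F := Module.finite_of_finrank_pos (by omega)
  set g := f.prod (f ∘ₗ LinearMap.mulLeft L ν)
  have hg : Function.Surjective g := surjective_prod_mulLeft f b hfb ν x hx hνx
  have hker : finrank L (LinearMap.ker g) = l - 1 := by
    have h := LinearMap.finrank_range_add_finrank_ker g
    rw [LinearMap.range_eq_top.2 hg, finrank_top, Module.finrank_prod, Module.finrank_self,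
      hF] at h
    omega
  have hkerK : Module.rank K (LinearMap.ker (g.restrictScalars K)) =
      Module.rank K L * ((l - 1 : ℕ) : Cardinal) := by
    rw [← hker, Module.finrank_eq_rank, rank_mul_rank K L (LinearMap.ker g)]
    rfl
  have hprod : Module.rank K (V.prod V) = ((2 * m : ℕ) : Cardinal) := by
    let e : (V.prod V) ≃ₗ[K] V × V :=
      { toFun := fun x => (⟨x.1.1, x.2.1⟩, ⟨x.1.2, x.2.2⟩)
        invFun := fun x => ⟨(x.1, x.2), x.1.2, x.2.2⟩
        map_add' := fun _ _ => rfl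
        map_smul' := fun _ _ => rfl }
    rw [e.rank_eq, rank_prod', hV]
    push_cast
    ring
  rw [← hkerK, ← hprod, ← rank_comap_of_surjective (g.restrictScalars K) hg]
  rfl

/-- If `x ↦ μ⁻¹ x` maps a finite-dimensional `W` into itself, then `μ` stabilizes `W`. -/
theorem mem_HStabSet_of_inv_mul_mem (W : Submodule L F) [FiniteDimensional L W] (μ : F)
    (hμ : μ ≠ 0) (h : ∀ x ∈ W, μ⁻¹ * x ∈ W) : μ ∈ HStabSet (W : Set F) := by
  have hinj : Function.Injective ((LinearMap.mulLeft L μ⁻¹).restrict h) := by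
    intro x y hxy
    have : μ⁻¹ * (x : F) = μ⁻¹ * y := congrArg Subtype.val hxy
    exact Subtype.ext (mul_left_cancel₀ (inv_ne_zero hμ) this)
  have hsurj := LinearMap.injective_iff_surjective.1 hinj
  refine Or.inl ⟨hμ, Set.Subset.antisymm ?_ ?_⟩
  · rintro _ ⟨y, hy, rfl⟩
    obtain ⟨x, hx⟩ := hsurj ⟨y, hy⟩
    have : μ⁻¹ * (x : F) = y := congrArg Subtype.val hx
    rw [← this]
    simp [hμ]
  · intro y hy
    exact ⟨μ⁻¹ * y, h y hy, by simp [hμ]⟩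

/-- A vector spanning a complement of `W` is detected by a functional with kernel `W`. -/
theorem exists_functional_ker_eq (W : Submodule L F) (b : F)
    (hb : ∀ c : L, c • b ∈ W → c = 0) (htop : W ⊔ Submodule.span L {b} = ⊤) :
    ∃ f : F →ₗ[L] L, f b = 1 ∧ LinearMap.ker f = W := by
  have hbW : b ∉ W := fun h => one_ne_zero (hb 1 (by simpa using h))
  obtain ⟨f, hfb, hf⟩ := Submodule.exists_le_ker_of_notMem hbW
  refine ⟨(f b)⁻¹ • f, by simp [hfb], le_antisymm ?_ ?_⟩
  · intro x hx
    obtain ⟨y, hy, z, hz, rfl⟩ := Submodule.mem_sup.1 (htop ▸ Submodule.mem_top : x ∈ _)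
    obtain ⟨c, rfl⟩ := Submodule.mem_span_singleton.1 hz
    have hfy : f y = 0 := hf hy
    have hc : c = 0 := by simpa [hfy, hfb] using hx
    simpa [hc] using hy
  · intro x hx
    have hfx : f x = 0 := hf hx
    simp [hfx]

/-- The span of the first `m` powers of `x` has dimension `m` if `x` has degree at least `m`. -/
theorem rank_span_pow_lt (x : L) {m : ℕ} (hm : m ≤ (minpoly K x).natDegree) :
    Module.rank K (Submodule.span K {y : L | ∃ j < m, y = x ^ j}) = m := by
  have hli : LinearIndependent K fun i : Fin m => x ^ (i : ℕ) :=
    (linearIndependent_pow x).comp (Fin.castLE hm) (Fin.castLE_injective hm)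
  have hset : {y : L | ∃ j < m, y = x ^ j} = Set.range fun i : Fin m => x ^ (i : ℕ) := by
    ext y
    constructor
    · rintro ⟨j, hj, rfl⟩
      exact ⟨⟨j, hj⟩, rfl⟩
    · rintro ⟨i, rfl⟩
      exact ⟨i, i.2, rfl⟩
  have : Module.Finite K (Submodule.span K (Set.range fun i : Fin m => x ^ (i : ℕ))) :=
    Module.Finite.span_of_finite K (Set.finite_range _)
  rw [hset, ← Module.finrank_eq_rank, finrank_span_eq_card hli, Fintype.card_fin]

/-- The dimension of `F` when a hyperplane is the kernel of a functional. -/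
theorem finrank_eq_finrank_ker_add_one (f : F →ₗ[L] L) (b : F) (hfb : f b = 1) {l : ℕ}
    (hl : 0 < l) (hker : finrank L (LinearMap.ker f) = l) : finrank L F = l + 1 := by
  have : FiniteDimensional L (LinearMap.ker f) := Module.finite_of_finrank_pos (by omega)
  have hsurj : Function.Surjective f := fun c => ⟨c • b, by simp [hfb]⟩
  have h := LinearMap.rank_eq_of_surjective hsurj
  rw [rank_self, ← Module.finrank_eq_rank L (LinearMap.ker f), hker] at h
  apply Module.finrank_eq_of_rank_eq
  rw [h]
  push_cast
  ring

/-- If a nonzero `L`-subspace of dimension `l` lies in a `K`-subspace of positive finite dimension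
less than `deg x * (l + 1)`, then `x` has full degree in `L`. -/
theorem finrank_eq_natDegree_minpoly (W : Submodule L F) (hW : 0 < finrank L W)
    (T : Submodule K F) (hWT : W.restrictScalars K ≤ T) (hT : 0 < finrank K T) (x : L)
    (hlt : finrank K T < (minpoly K x).natDegree * (finrank L W + 1)) :
    finrank K L = (minpoly K x).natDegree := by
  have : FiniteDimensional K T := Module.finite_of_finrank_pos hT
  have hfin : FiniteDimensional K (W.restrictScalars K) := Submodule.finiteDimensional_of_le hWT
  have hbound : finrank K L * finrank L W ≤ finrank K T := by
    rw [Module.finrank_mul_finrank K L W]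
    exact Submodule.finrank_mono hWT
  have : Nontrivial W := Module.nontrivial_of_finrank_pos hW
  obtain ⟨w, hw⟩ := exists_ne (0 : W)
  let g : L →ₗ[K] W.restrictScalars K := (LinearMap.toSpanSingleton L W w).restrictScalars K
  have : FiniteDimensional K L :=
    Module.Finite.of_injective g fun c d hcd => smul_left_injective L hw hcd
  obtain ⟨e, he⟩ := minpoly.degree_dvd (Algebra.IsIntegral.isIntegral (R := K) x)
  have hpos : 0 < finrank K L := Module.finrank_pos
  set t := (minpoly K x).natDegree
  have he2 : e < 2 := by
    by_contra! h
    rw [he] at hbound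
    have h1 : t * 2 * finrank L W ≤ t * e * finrank L W := by gcongr
    have h2 : t * 1 ≤ t * finrank L W := Nat.mul_le_mul_left t hW
    nlinarith
  interval_cases e <;> omega

end Helpers

/-- For `α ≠ 0`, membership in `αS` is membership of the quotient by `α` in `S`. -/
theorem smulSub_eq_comap {F : Type*} [Field F] (Fq : Subfield F) (α : F) (hα : α ≠ 0)
    (S : Submodule Fq F) : smulSub Fq α S = S.comap (LinearMap.mulLeft Fq α⁻¹) := by
  ext x
  constructor
  · rintro ⟨y, hy, rfl⟩
    simpa [hα] using hy
  · intro hx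
    exact ⟨α⁻¹ * x, hx, by simp [hα]⟩

/-- suppose `Y = F` (so `n = t(l+1)`) and `2m ≥ t - 1`, suppose `Orb(S)` is an
`r`-FWS code with `r = 2m + t(l-1)`, and let `μ ∈ Fˣ` with `μ ∉ H(S̄)`. Then
`dim_{Fq}(S ∩ μS) = t(l-1) + 2m`. -/
theorem stmt12 (q n : ℕ) (hn : 0 < n)
    (F : Type*) [Field F] (hF : Nat.card F = q ^ n)
    (Fq Fqt : Subfield F) (hq : Nat.card Fq = q) (hle : Fq ≤ Fqt)
    (lam : F) (hlam : lam ∉ Fq) (hmem : lam ∈ Fqt)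
    (t : ℕ) (ht : t = (minpoly Fq lam).natDegree) (hqt : Nat.card Fqt = q ^ t)
    (l : ℕ) (hl : 0 < l)
    (Sbar : Submodule Fqt F) (hSbar : finrank Fqt Sbar = l)
    (b : F) (hb : b ≠ 0)
    (hbint : {x : F | ∃ c ∈ Fqt, x = b * c} ∩ (Sbar : Set F) = {0})
    (m : ℕ) (hm1 : 0 < m) (hm2 : m < t)
    (Sm : Submodule Fq F) (hSm : Sm = Submodule.span Fq {x : F | ∃ j < m, x = lam ^ j})
    (S : Submodule Fq F) (hS : S = toFqSub Fq Fqt hle Sbar ⊔ smulSub Fq b Sm)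
    (Y : Submodule Fq F)
    (hY : Y = toFqSub Fq Fqt hle Sbar ⊔ smulSub Fq b (subfieldModule Fq Fqt hle))
    (hYtop : Y = ⊤) (hnt : n = t * (l + 1)) (hm : t ≤ 2 * m + 1)
    (hFWS : IsRFWS Fq S (t * l + m) (2 * m + t * (l - 1)))
    (μ : F) (hμ : μ ≠ 0) (hμH : μ ∉ HStabSet (Sbar : Set F)) :
    finrank Fq ↥(S ⊓ smulSub Fq μ S) = t * (l - 1) + 2 * m := by
  let : Algebra Fq Fqt := (Subfield.inclusion hle).toAlgebra
  have : IsScalarTower Fq Fqt F := IsScalarTower.of_algebraMap_eq fun _ => rfl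
  have hcomplement : ∀ c : Fqt, c • b ∈ Sbar → c = 0 := by
    intro c hc
    have h0 : c • b ∈ ({0} : Set F) := by
      rw [← hbint]
      exact ⟨⟨c, c.2, mul_comm _ _⟩, hc⟩
    exact (smul_eq_zero.1 h0).resolve_right hb
  have htop : Sbar ⊔ Submodule.span Fqt {b} = ⊤ := by
    rw [eq_top_iff]
    intro x _
    have hx : x ∈ Y := hYtop ▸ Submodule.mem_top
    rw [hY] at hx
    obtain ⟨y, hy, _, ⟨c, hc, rfl⟩, rfl⟩ := Submodule.mem_sup.1 hx
    exact Submodule.add_mem_sup hy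
      (Submodule.mem_span_singleton.2 ⟨⟨c, hc⟩, mul_comm _ _⟩)
  obtain ⟨f, hfb, hker⟩ := exists_functional_ker_eq Sbar b hcomplement htop
  have hfS : ∀ x, f x = 0 ↔ x ∈ Sbar := fun x => by rw [← hker, LinearMap.mem_ker]
  have hFrank : finrank Fqt F = l + 1 :=
    finrank_eq_finrank_ker_add_one f b hfb hl (hker ▸ hSbar)
  have : FiniteDimensional Fqt Sbar := Module.finite_of_finrank_pos (by omega)
  have hdeg : (minpoly Fq (⟨lam, hmem⟩ : Fqt)).natDegree = t := by
    rw [ht, ← minpoly.algebraMap_eq (B' := F) (algebraMap Fqt F).injective]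
    rfl
  set V : Submodule Fq Fqt :=
    Submodule.span Fq {y : Fqt | ∃ j < m, y = (⟨lam, hmem⟩ : Fqt) ^ j} with hVdef
  have hV : Module.rank Fq V = m := rank_span_pow_lt _ (by omega)
  have hSmV : ∀ c : Fqt, c ∈ V ↔ (c : F) ∈ Sm := by
    have hmap : Sm = V.map (IsScalarTower.toAlgHom Fq Fqt F).toLinearMap := by
      rw [hSm, hVdef, Submodule.map_span]
      congr 1
      ext x
      constructor
      · rintro ⟨j, hj, rfl⟩
        exact ⟨_, ⟨j, hj, rfl⟩, rfl⟩
      · rintro ⟨_, ⟨j, hj, rfl⟩, rfl⟩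
        exact ⟨j, hj, rfl⟩
    intro c
    rw [hmap]
    constructor
    · exact fun hc => ⟨c, hc, rfl⟩
    · rintro ⟨d, hd, hdc⟩
      exact (Subtype.ext hdc : d = c) ▸ hd
  have hSm_le : ∀ x ∈ Sm, x ∈ Fqt := by
    have hspan : Sm ≤ subfieldModule Fq Fqt hle := by
      rw [hSm, Submodule.span_le]
      rintro _ ⟨j, -, rfl⟩
      exact pow_mem hmem j
    exact fun x hx => hspan hx
  have hScomap : S = V.comap (f.restrictScalars Fq) := by
    ext x
    rw [hS, Submodule.mem_comap, LinearMap.restrictScalars_apply, hSmV]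
    constructor
    · intro hx
      obtain ⟨y, hy, _, ⟨c, hc, rfl⟩, rfl⟩ := Submodule.mem_sup.1 hx
      have hcb : f (b * c) = ⟨c, hSm_le c hc⟩ := by
        have : b * c = (⟨c, hSm_le c hc⟩ : Fqt) • b := mul_comm _ _
        rw [this, map_smul, hfb, smul_eq_mul, mul_one]
      rw [map_add, (hfS y).2 hy, LinearMap.mulLeft_apply, hcb, zero_add]
      exact hc
    · intro hx
      refine Submodule.mem_sup.2 ⟨x - f x • b, (hfS _).1 (by simp [hfb]), b * (f x : F),
        ⟨_, hx, rfl⟩, ?_⟩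
      rw [Subfield.smul_def, smul_eq_mul]
      ring
  have hgeneric : ∀ α : F, α ≠ 0 → α ∉ HStabSet (Sbar : Set F) →
      Module.rank Fq ↥(S ⊓ smulSub Fq α S) =
        ((2 * m : ℕ) : Cardinal) + Module.rank Fq Fqt * ((l - 1 : ℕ) : Cardinal) := by
    intro α hα hαH
    obtain ⟨x, hx, hαx⟩ : ∃ x ∈ Sbar, α⁻¹ * x ∉ Sbar := by
      by_contra! h
      exact hαH (mem_HStabSet_of_inv_mul_mem Sbar α hα h)
    rw [smulSub_eq_comap Fq α hα, hScomap]
    exact rank_comap_inf_comap_mulLeft hl hFrank f b hfb α⁻¹ x ((hfS x).2 hx)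
      (fun h => hαx ((hfS _).1 h)) V hV
  have hprod : t * l = t * (l - 1) + t := by
    obtain ⟨l, rfl⟩ := Nat.exists_eq_add_of_lt hl
    simp [Nat.mul_add]
  have hpos := hFWS.1 (t - m) (by omega) (by omega)
  obtain ⟨_, ⟨α, hα, rfl⟩, hαrank⟩ := Set.nonempty_of_ncard_ne_zero hpos.ne'
  have hαdim : finrank Fq ↥(S ⊓ smulSub Fq α S) = t * (l - 1) + 2 * m := by omega
  by_cases hαH : α ∈ HStabSet (Sbar : Set F)
  · have himage : (fun y => α * y) '' (Sbar : Set F) = Sbar :=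
      (hαH.resolve_right fun h => hα h).2
    have hSbarS : Sbar.restrictScalars Fq ≤ S := by
      rw [hS]
      exact le_sup_of_le_left fun _ hx => hx
    have hle_inf : Sbar.restrictScalars Fq ≤ S ⊓ smulSub Fq α S := by
      refine le_inf hSbarS fun x hx => ?_
      have hx' : x ∈ (fun y => α * y) '' (Sbar : Set F) :=
        himage.symm ▸ (show x ∈ (Sbar : Set F) from hx)
      obtain ⟨y, hy, rfl⟩ := hx'
      exact ⟨y, hSbarS hy, rfl⟩
    have hdegree : finrank Fq Fqt = t := by
      rw [← hdeg]
      refine finrank_eq_natDegree_minpoly Sbar (by omega) _ hle_inf (by omega) _ ?_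
      rw [hdeg, hSbar, hαdim, Nat.mul_add]
      omega
    have : FiniteDimensional Fq Fqt := Module.finite_of_finrank_pos (by omega)
    have h := hgeneric μ hμ hμH
    rw [← Module.finrank_eq_rank Fq Fqt, hdegree] at h
    apply Module.finrank_eq_of_rank_eq
    rw [h]
    push_cast
    ring
  · rw [← hαdim, Module.finrank, Module.finrank, hgeneric μ hμ hμH, hgeneric α hα hαH]
end
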